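/- Let w̃₂ ∈ W̃₁, let α be a simple root, and let ω ∈ X be such that t_ω s_α w̃₂ ∈ W̃₁. Then: (1) ⟨ω,α∨⟩ = 1; (2) if β is a simple root orthogonal to α (i.e. ⟨β,α∨⟩=0), then ⟨ω,β∨⟩ = 0; (3) if β is a simple root with ⟨β,α∨⟩ ≤ 0, then ⟨ω,β∨⟩ ≤ 0; (4) if γ is a positive root with ⟨ω_α,γ∨⟩ ≤ 1, then ⟨ω,γ∨⟩ ≤ 1. -/

import Mathlib

open scoped Classical Pointwise

namespace SerrePaper

variable (V : Type) [AddCommGroup V] [Module ℝ V]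

/-- The combinatorial context of the paper: the character lattice `X` of a split maximal
torus, sitting inside the real vector space `V = X ⊗ ℝ`, together with a reduced
crystallographic root system `R` with positive roots `Rpos`, simple roots `Δ`,
the coroot pairing `coroot α = ⟨·, α∨⟩`, the weight `η` pairing to `1` with every simple
coroot, and the longest element `w0` of the Weyl group. -/
structure Ctx where
  R : Finset V
  Rpos : Finset V
  Δ : Finset V
  coroot : V → V →ₗ[ℝ] ℝ
  eta : V
  w0 : V ≃ₗ[ℝ] V
  X : AddSubgroup V
  pos_subset : Rpos ⊆ R
  simple_subset : Δ ⊆ Rpos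
  root_ne_zero : ∀ α ∈ R, α ≠ (0 : V)
  neg_mem : ∀ α ∈ R, -α ∈ R
  pos_or_neg : ∀ α ∈ R, α ∈ Rpos ∨ -α ∈ Rpos
  pos_not_neg : ∀ α ∈ Rpos, -α ∉ Rpos
  coroot_self : ∀ α ∈ R, coroot α α = 2
  coroot_neg : ∀ α ∈ R, coroot (-α) = -coroot α
  crystallographic : ∀ α ∈ R, ∀ β ∈ R, ∃ n : ℤ, coroot α β = (n : ℝ)
  reduced : ∀ α ∈ R, ∀ c : ℝ, c • α ∈ R → c = 1 ∨ c = -1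
  reflect_root : ∀ α ∈ R, ∀ β ∈ R, β - coroot α β • α ∈ R
  reflect_coroot : ∀ α ∈ R, ∀ β ∈ R, ∀ x : V,
    coroot (β - coroot α β • α) x = coroot β x - coroot β α * coroot α x
  pos_sum_simple : ∀ α ∈ Rpos, ∃ c : V → ℕ, α = ∑ β ∈ Δ, (c β : ℝ) • β
  simple_indep : LinearIndependent ℝ (fun β : {x // x ∈ Δ} => (β : V))
  eta_pair : ∀ α ∈ Δ, coroot α eta = 1
  root_mem_X : ∀ α ∈ R, α ∈ X
  eta_mem_X : eta ∈ X
  coroot_int : ∀ α ∈ R, ∀ x ∈ X, ∃ n : ℤ, coroot α x = (n : ℝ)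
  w0_mem : w0 ∈ Subgroup.closure {g : V ≃ₗ[ℝ] V | ∃ α ∈ R, ∀ x, g x = x - coroot α x • α}
  w0_neg : ∀ α ∈ Rpos, -(w0 α) ∈ Rpos

namespace Ctx

variable {V}
variable (S : Ctx V)

/-- The (finite) Weyl group, generated by the reflections `s_α`, `α ∈ R`. -/
def Weyl : Subgroup (V ≃ₗ[ℝ] V) :=
  Subgroup.closure {g : V ≃ₗ[ℝ] V | ∃ α ∈ S.R, ∀ x, g x = x - S.coroot α x • α}

/-- The translation `t_ν` as an affine automorphism of `V`. -/
def trans (_S : Ctx V) (ν : V) : V ≃ᵃ[ℝ] V := AffineEquiv.constVAdd ℝ V ν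

/-- A linear automorphism viewed as an affine automorphism. -/
def ofW (_S : Ctx V) (w : V ≃ₗ[ℝ] V) : V ≃ᵃ[ℝ] V := w.toAffineEquiv

/-- The extended affine Weyl group `W̃ = X ⋊ W`, realized as the set of affine
transformations of the form `t_ν ∘ w` with `ν ∈ X` and `w ∈ W`. -/
def extAff : Set (V ≃ᵃ[ℝ] V) :=
  {g | ∃ ν ∈ S.X, ∃ w ∈ S.Weyl, g = S.trans ν * S.ofW w}

/-- The base alcove `A₀`. -/
def A0 : Set V := {x | ∀ α ∈ S.Rpos, 0 < S.coroot α x ∧ S.coroot α x < 1}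

/-- The affine hyperplane `⟨·,α∨⟩ = n` separates the base alcove `A₀` from its image
`g(A₀)`. -/
def Separates (α : V) (n : ℤ) (g : V ≃ᵃ[ℝ] V) : Prop :=
  ((∀ x ∈ S.A0, S.coroot α x < (n : ℝ)) ∧ (∀ x ∈ S.A0, (n : ℝ) < S.coroot α (g x))) ∨
  ((∀ x ∈ S.A0, (n : ℝ) < S.coroot α x) ∧ (∀ x ∈ S.A0, S.coroot α (g x) < (n : ℝ)))

/-- The length `ℓ(g)` of an element of the extended affine Weyl group: the number of
affine root hyperplanes separating `A₀` from `g(A₀)`. -/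
noncomputable def len (g : V ≃ᵃ[ℝ] V) : ℕ :=
  Set.ncard {q : V × ℤ | q.1 ∈ S.Rpos ∧ S.Separates q.1 q.2 g}

/-- The set of affine reflections `s_{α,n} : x ↦ x - (⟨x,α∨⟩ - n)α`. -/
def affRefl : Set (V ≃ᵃ[ℝ] V) :=
  {g | ∃ α ∈ S.R, ∃ n : ℤ, ∀ x, g x = x - (S.coroot α x - (n : ℝ)) • α}

/-- The Bruhat order on the extended affine Weyl group, generated by
`u < r·u` for affine reflections `r` with `ℓ(u) < ℓ(r·u)` (this fixes the
`Ω`-component, so it is the componentwise extension of the Bruhat order on `W_a`). -/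
def bruhatLE : (V ≃ᵃ[ℝ] V) → (V ≃ᵃ[ℝ] V) → Prop :=
  Relation.ReflTransGen fun u w => (∃ r ∈ S.affRefl, w = r * u) ∧ S.len u < S.len w

/-- Jantzen's `↑`-order, transported to the (extended) affine Weyl group via
`w̃ ↦ w̃(A₀)`: generated by `u ↑ s_{α,n}·u` whenever `u(A₀)` lies below the hyperplane
`⟨·,α∨⟩ = n`.  (Under the affine rescaling `λ ↦ (λ+η)/p` this is equivalent to the usual
`↑`-order on `p`-alcoves, transported via the `p`-dot action `w̃ ↦ w̃ · C₀`.) -/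
def upLE : (V ≃ᵃ[ℝ] V) → (V ≃ᵃ[ℝ] V) → Prop :=
  Relation.ReflTransGen fun u w =>
    ∃ α ∈ S.Rpos, ∃ n : ℤ,
      (∀ x : V, w x = u x - (S.coroot α (u x) - (n : ℝ)) • α) ∧
      ∀ x ∈ S.A0, S.coroot α (u x) < (n : ℝ)

/-- `W̃⁺`: the elements of `W̃` taking the base alcove to a dominant alcove. -/
def Wplus : Set (V ≃ᵃ[ℝ] V) :=
  {g | g ∈ S.extAff ∧ ∀ x ∈ S.A0, ∀ α ∈ S.Δ, 0 < S.coroot α (g x)}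

/-- `W̃₁`: the elements of `W̃` taking the base alcove to a restricted alcove. -/
def Wone : Set (V ≃ᵃ[ℝ] V) :=
  {g | g ∈ S.extAff ∧ ∀ x ∈ S.A0, ∀ α ∈ S.Δ,
    0 < S.coroot α (g x) ∧ S.coroot α (g x) < 1}

/-- `w̃_h = w₀ t_{-η}`. -/
noncomputable def wh : V ≃ᵃ[ℝ] V := S.ofW S.w0 * S.trans (-S.eta)

/-- The lowest `p`-alcove `C₀`. -/
def C0 (p : ℕ) : Set V :=
  {x | ∀ α ∈ S.Rpos, 0 < S.coroot α (x + S.eta) ∧ S.coroot α (x + S.eta) < (p : ℝ)}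

/-- The root lattice `ℤR`. -/
def rootLattice : AddSubgroup V := AddSubgroup.closure (S.R : Set V)

/-- `Ω`: the stabilizer of the base alcove in `W̃`. -/
def Omega : Set (V ≃ᵃ[ℝ] V) := {g | g ∈ S.extAff ∧ g '' S.A0 = S.A0}

/-- The `λ`-admissible set `Adm(λ) = ⋃_{w ∈ W} W̃_{≤ t_{w(λ)}}`. -/
def Adm (lam : V) : Set (V ≃ᵃ[ℝ] V) :=
  {g | ∃ w ∈ S.Weyl, S.bruhatLE g (S.trans (w lam))}

/-- `α∨` is a highest coroot, i.e. the highest root of an irreducible component of the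
dual root system `R∨`: equivalently, `α∨` is a dominant coroot and no simple coroot can
be added to `α∨` to yield a coroot. -/
def IsHighestCoroot (α : V) : Prop :=
  α ∈ S.R ∧ (∀ β ∈ S.Δ, 0 ≤ S.coroot α β) ∧
    ∀ β ∈ S.Δ, ∀ γ ∈ S.R, S.coroot γ ≠ S.coroot α + S.coroot β

end Ctx


namespace Ctx

variable {V : Type} [AddCommGroup V] [Module ℝ V] (S : Ctx V)

/-- The Weyl-invariant symmetric bilinear form `(x, y) ↦ ∑ ⟨x,γ∨⟩⟨y,γ∨⟩`, summed over all roots. -/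
noncomputable def form (x : V) : V →ₗ[ℝ] ℝ := ∑ γ ∈ S.R, S.coroot γ x • S.coroot γ

lemma form_apply (x y : V) : S.form x y = ∑ γ ∈ S.R, S.coroot γ x * S.coroot γ y := by
  simp [form]

lemma form_comm (x y : V) : S.form x y = S.form y x := by
  simp only [form_apply, mul_comm]

lemma form_self_pos {α : V} (hα : α ∈ S.R) : 0 < S.form α α := by
  rw [form_apply]
  refine Finset.sum_pos' (fun γ _ => mul_self_nonneg _) ⟨α, hα, ?_⟩
  rw [S.coroot_self α hα]
  norm_num

lemma form_reflect {α : V} (hα : α ∈ S.R) (x y : V) :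
    S.form (x - S.coroot α x • α) (y - S.coroot α y • α) = S.form x y := by
  rw [form_apply, form_apply]
  have hinv (γ : V) : γ - S.coroot α γ • α - S.coroot α (γ - S.coroot α γ • α) • α = γ := by
    rw [map_sub, map_smul, S.coroot_self α hα, smul_eq_mul]
    module
  refine Finset.sum_bij' (fun γ _ => γ - S.coroot α γ • α) (fun γ _ => γ - S.coroot α γ • α)
    (fun γ hγ => S.reflect_root α hα γ hγ) (fun γ hγ => S.reflect_root α hα γ hγ)
    (fun γ _ => hinv γ) (fun γ _ => hinv γ) (fun γ hγ => ?_)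
  rw [S.reflect_coroot α hα γ hγ, S.reflect_coroot α hα γ hγ]
  simp only [map_sub, map_smul, smul_eq_mul]
  ring

lemma coroot_mul_form_self {α : V} (hα : α ∈ S.R) (x : V) :
    S.coroot α x * S.form α α = 2 * S.form α x := by
  have h := S.form_reflect hα x α
  rw [S.coroot_self α hα, show α - (2 : ℝ) • α = -α by module, map_neg,
    form_comm S (x - _) α, map_sub, map_smul, smul_eq_mul, form_comm S x α] at h
  linarith

lemma coroot_eq_zero_symm {α β : V} (hα : α ∈ S.R) (hβ : β ∈ S.R) (h : S.coroot α β = 0) :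
    S.coroot β α = 0 := by
  have h₁ := S.coroot_mul_form_self hα β
  have h₂ := S.coroot_mul_form_self hβ α
  rw [h, zero_mul] at h₁
  rw [form_comm S β α, ← h₁] at h₂
  exact (mul_eq_zero.mp h₂).resolve_right (S.form_self_pos hβ).ne'

lemma coroot_nonpos_symm {α β : V} (hα : α ∈ S.R) (hβ : β ∈ S.R) (h : S.coroot α β ≤ 0) :
    S.coroot β α ≤ 0 := by
  have h₁ := S.coroot_mul_form_self hα β
  have h₂ := S.coroot_mul_form_self hβ α
  have h₃ := mul_nonpos_of_nonpos_of_nonneg h (S.form_self_pos hα).le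
  rw [form_comm S β α] at h₂
  exact nonpos_of_mul_nonpos_left (by linarith) (S.form_self_pos hβ)

lemma mem_R_of_mem_simple {α : V} (hα : α ∈ S.Δ) : α ∈ S.R :=
  S.pos_subset (S.simple_subset hα)

/-- A positive coroot is a nonzero nonnegative combination of simple coroots. -/
lemma exists_coroot_eq_sum {γ : V} (hγ : γ ∈ S.Rpos) :
    ∃ c : V → ℝ, (∀ β ∈ S.Δ, 0 ≤ c β) ∧ (∃ β ∈ S.Δ, 0 < c β) ∧
      ∀ x, S.coroot γ x = ∑ β ∈ S.Δ, c β * S.coroot β x := by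
  obtain ⟨c, hc⟩ := S.pos_sum_simple γ hγ
  have hγR := S.pos_subset hγ
  have hγγ := S.form_self_pos hγR
  have hΔ (β : V) (hβ : β ∈ S.Δ) := S.form_self_pos (S.mem_R_of_mem_simple hβ)
  refine ⟨fun β => c β * S.form β β / S.form γ γ, fun β hβ => ?_, ?_, fun x => ?_⟩
  · have := hΔ β hβ
    positivity
  · by_contra! hzero
    refine S.root_ne_zero γ hγR (hc.trans (Finset.sum_eq_zero fun β hβ => ?_))
    rcases Nat.eq_zero_or_pos (c β) with h | h
    · simp [h]
    · have hpos := hΔ β hβ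
      have : (0 : ℝ) < c β := by exact_mod_cast h
      exact absurd (hzero β hβ) (not_le.mpr (by positivity))
  · have hsum : S.form γ x = ∑ β ∈ S.Δ, c β * S.form β x := by
      rw [form_comm]
      conv_lhs => rw [hc]
      simp only [map_sum, map_smul, smul_eq_mul]
      simp only [form_comm S x]
    apply mul_right_cancel₀ hγγ.ne'
    rw [S.coroot_mul_form_self hγR, hsum, Finset.mul_sum, Finset.sum_mul]
    refine Finset.sum_congr rfl fun β hβ => ?_
    have h := S.coroot_mul_form_self (S.mem_R_of_mem_simple hβ) x
    field_simp
    linear_combination -(c β : ℝ) * h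

lemma coroot_eta_pos {γ : V} (hγ : γ ∈ S.Rpos) : 0 < S.coroot γ S.eta := by
  obtain ⟨c, hc, ⟨β, hβ, hpos⟩, hsum⟩ := S.exists_coroot_eq_sum hγ
  rw [hsum]
  refine Finset.sum_pos' (fun δ hδ => ?_) ⟨β, hβ, ?_⟩
  · rw [S.eta_pair δ hδ, mul_one]
    exact hc δ hδ
  · rwa [S.eta_pair β hβ, mul_one]

lemma A0_nonempty : S.A0.Nonempty := by
  have hnonneg : 0 ≤ ∑ γ ∈ S.Rpos, S.coroot γ S.eta :=
    Finset.sum_nonneg fun γ hγ => (S.coroot_eta_pos hγ).le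
  refine ⟨(1 + ∑ γ ∈ S.Rpos, S.coroot γ S.eta)⁻¹ • S.eta, fun γ hγ => ?_⟩
  have hle : S.coroot γ S.eta ≤ ∑ γ ∈ S.Rpos, S.coroot γ S.eta :=
    Finset.single_le_sum (f := fun γ => S.coroot γ S.eta)
      (fun δ hδ => (S.coroot_eta_pos hδ).le) hγ
  have hpos := S.coroot_eta_pos hγ
  rw [map_smul, smul_eq_mul]
  refine ⟨by positivity, ?_⟩
  rw [inv_mul_lt_one₀ (by positivity)]
  linarith

lemma eq_zero_of_sum_simple_eq_zero {g : V → ℝ} (hg : ∑ β ∈ S.Δ, g β • β = 0) {β : V}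
    (hβ : β ∈ S.Δ) : g β = 0 :=
  linearIndepOn_finset_iff.mp (show LinearIndepOn ℝ id (S.Δ : Set V) from S.simple_indep) g hg β hβ

lemma coroot_simple_nonpos {α β : V} (hα : α ∈ S.Δ) (hβ : β ∈ S.Δ) (hne : β ≠ α) :
    S.coroot α β ≤ 0 := by
  by_contra! hpos
  have hdiff : β - S.coroot α β • α =
      ∑ δ ∈ S.Δ, ((if δ = β then 1 else 0) - if δ = α then S.coroot α β else 0 : ℝ) • δ := by
    simp [sub_smul, Finset.sum_sub_distrib, ite_smul, Finset.sum_ite_eq', hα, hβ]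
  rcases S.pos_or_neg _ (S.reflect_root α (S.mem_R_of_mem_simple hα) β
    (S.mem_R_of_mem_simple hβ)) with h | h
  · obtain ⟨c, hc⟩ := S.pos_sum_simple _ h
    rw [hdiff, ← sub_eq_zero, ← Finset.sum_sub_distrib] at hc
    simp only [← sub_smul] at hc
    have := S.eq_zero_of_sum_simple_eq_zero hc hα
    simp only [hne.symm, if_true, if_false] at this
    have : (0 : ℝ) ≤ c α := Nat.cast_nonneg _
    linarith
  · obtain ⟨c, hc⟩ := S.pos_sum_simple _ h
    rw [hdiff, eq_comm, ← add_eq_zero_iff_eq_neg, ← Finset.sum_add_distrib] at hc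
    simp only [← add_smul] at hc
    have := S.eq_zero_of_sum_simple_eq_zero hc hβ
    simp only [hne, if_true, if_false] at this
    have : (0 : ℝ) ≤ c β := Nat.cast_nonneg _
    linarith

end Ctx

/-- Lemma `omega`: properties of `ω` when `t_ω s_α w̃₂ ∈ W̃₁`. -/
theorem statement1 {V : Type} [AddCommGroup V] [Module ℝ V] [FiniteDimensional ℝ V]
    (S : Ctx V)
    (w₂ : V ≃ᵃ[ℝ] V) (hw₂ : w₂ ∈ S.Wone)
    (α : V) (hα : α ∈ S.Δ)
    (sα : V ≃ₗ[ℝ] V) (hsα : ∀ x, sα x = x - S.coroot α x • α)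
    (ωα : V) (hωαX : ωα ∈ S.X)
    (hωαf : ∀ β ∈ S.Δ, S.coroot β ωα = if β = α then 1 else 0)
    (ω : V) (hω : ω ∈ S.X)
    (hmem : S.trans ω * (S.ofW sα * w₂) ∈ S.Wone) :
    S.coroot α ω = 1 ∧
    (∀ β ∈ S.Δ, S.coroot α β = 0 → S.coroot β ω = 0) ∧
    (∀ β ∈ S.Δ, S.coroot α β ≤ 0 → S.coroot β ω ≤ 0) ∧
    (∀ γ ∈ S.Rpos, S.coroot γ ωα ≤ 1 → S.coroot γ ω ≤ 1) := by
  obtain ⟨x, hx⟩ := S.A0_nonempty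
  have hαR := S.mem_R_of_mem_simple hα
  have hy (β : V) (hβ : β ∈ S.Δ) := hw₂.2 x hx β hβ
  have hz (β : V) (hβ : β ∈ S.Δ) :
      0 < S.coroot β ω + (S.coroot β (w₂ x) - S.coroot α (w₂ x) * S.coroot β α) ∧
      S.coroot β ω + (S.coroot β (w₂ x) - S.coroot α (w₂ x) * S.coroot β α) < 1 := by
    have h := hmem.2 x hx β hβ
    have hval : (S.trans ω * (S.ofW sα * w₂)) x =
        ω + (w₂ x - S.coroot α (w₂ x) • α) := by
      rw [← hsα]
      rfl
    simpa only [hval, map_add, map_sub, map_smul, smul_eq_mul] using h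
  have hα₁ : S.coroot α ω = 1 := by
    obtain ⟨n, hn⟩ := S.coroot_int α hαR ω hω
    have h₁ := hy α hα
    have h₂ := hz α hα
    rw [S.coroot_self α hαR, hn] at h₂
    have hlow : (0 : ℝ) < n := by linarith
    have hupp : (n : ℝ) < 2 := by linarith
    norm_cast at hlow hupp
    rw [hn, show n = 1 by omega, Int.cast_one]
  have hnonpos (β : V) (hβ : β ∈ S.Δ) (h : S.coroot α β ≤ 0) : S.coroot β ω ≤ 0 := by
    have hβR := S.mem_R_of_mem_simple hβ
    obtain ⟨n, hn⟩ := S.coroot_int β hβR ω hω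
    have h₁ := hy β hβ
    have h₂ := hz β hβ
    have h₃ := mul_nonpos_of_nonneg_of_nonpos (hy α hα).1.le (S.coroot_nonpos_symm hαR hβR h)
    have hupp : S.coroot β ω < 1 := by linarith
    rw [hn] at hupp ⊢
    norm_cast at hupp ⊢
    omega
  refine ⟨hα₁, fun β hβ h => ?_, hnonpos, fun γ hγ h => ?_⟩
  · have hβR := S.mem_R_of_mem_simple hβ
    refine le_antisymm (hnonpos β hβ h.le) ?_
    obtain ⟨n, hn⟩ := S.coroot_int β hβR ω hω
    have h₁ := hy β hβ
    have h₂ := hz β hβ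
    rw [S.coroot_eq_zero_symm hαR hβR h] at h₂
    have hlow : -1 < S.coroot β ω := by linarith
    rw [hn] at hlow ⊢
    norm_cast at hlow ⊢
  · obtain ⟨c, hc, -, hsum⟩ := S.exists_coroot_eq_sum hγ
    refine le_trans ?_ h
    rw [hsum, hsum]
    refine Finset.sum_le_sum fun β hβ => mul_le_mul_of_nonneg_left ?_ (hc β hβ)
    rw [hωαf β hβ]
    split_ifs with hβα
    · rw [hβα, hα₁]
    · exact hnonpos β hβ (S.coroot_simple_nonpos hα hβ hβα)

end SerrePaper
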